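/- arXiv:2205.01879 — 6 statements merged into one kernel-verified Lean document; each statement's English description precedes it below -/
import Mathlib

section
/- Let k₁ > 0 and k₂ > 0. If S, v̂ : ℝ → ℝ are differentiable functions satisfying S′(t) = −k₁·S(t) and v̂′(t) = −k₁·S(t) − k₂·v̂(t) for all t, then S(t) → 0 and v̂(t) → 0 as t → +∞. (Convergence to the uniform flow equilibrium of the linear closed-loop system.) -/
open Filter Topology

/-- A nonnegative function satisfying `V' ≤ -c V` with `c > 0` tends to zero. -/
theorem tendsto_zero_of_deriv_le_neg_mul {V V' : ℝ → ℝ} {c : ℝ} (hc : 0 < c)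
    (hV : ∀ t, HasDerivAt V (V' t) t) (hV' : ∀ t, V' t ≤ -c * V t)
    (hV0 : ∀ t, 0 ≤ V t) : Tendsto V atTop (𝓝 0) := by
  have hW (t : ℝ) : HasDerivAt (fun t => V t * Real.exp (c * t))
      (V' t * Real.exp (c * t) + V t * (Real.exp (c * t) * (c * 1))) t :=
    (hV t).mul ((hasDerivAt_id t).const_mul c).exp
  have hanti : Antitone fun t => V t * Real.exp (c * t) := by
    refine antitone_of_deriv_nonpos (fun t => (hW t).differentiableAt) fun t => ?_
    rw [(hW t).deriv]
    nlinarith [mul_nonneg (sub_nonneg.2 (hV' t)) (Real.exp_pos (c * t)).le]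
  have hlim : Tendsto (fun t => V 0 * Real.exp (-(c * t))) atTop (𝓝 0) := by
    simpa using (Real.tendsto_exp_neg_atTop_nhds_zero.comp
      (tendsto_id.const_mul_atTop hc)).const_mul (V 0)
  refine squeeze_zero' (.of_forall hV0) ?_ hlim
  filter_upwards [eventually_ge_atTop 0] with t ht
  have h : V t * Real.exp (c * t) ≤ V 0 := by simpa using hanti ht
  rwa [Real.exp_neg, ← div_eq_mul_inv, le_div_iff₀ (Real.exp_pos _)]

/-- If `k * f ^ 2` is dominated by a function tending to zero, then `f` tends to zero. -/
theorem tendsto_zero_of_mul_sq_le {α : Type*} {l : Filter α} {f V : α → ℝ} {k : ℝ} (hk : 0 < k)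
    (hV : Tendsto V l (𝓝 0)) (h : ∀ t, k * f t ^ 2 ≤ V t) : Tendsto f l (𝓝 0) := by
  have hlim : Tendsto (fun t => √(V t / k)) l (𝓝 0) := by
    simpa using (hV.div_const k).sqrt
  refine squeeze_zero_norm (fun t => Real.abs_le_sqrt ?_) hlim
  rw [le_div_iff₀ hk, mul_comm]
  exact h t

/-- Convergence to the uniform flow equilibrium of the linear closed-loop
system: if `Ṡ = −k₁S` and `v̂̇ = −k₁S − k₂v̂` with `k₁, k₂ > 0`, then
`S(t) → 0` and `v̂(t) → 0` as `t → +∞`. -/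
theorem linear_closed_loop_convergence (k₁ k₂ : ℝ) (hk₁ : k₁ > 0) (hk₂ : k₂ > 0)
    (S v : ℝ → ℝ) (hS : Differentiable ℝ S) (hv : Differentiable ℝ v)
    (hS' : ∀ t, deriv S t = -k₁ * S t)
    (hv' : ∀ t, deriv v t = -k₁ * S t - k₂ * v t) :
    Tendsto S atTop (𝓝 0) ∧ Tendsto v atTop (𝓝 0) := by
  have hV (t : ℝ) : HasDerivAt (fun t => k₂ * v t ^ 2 + k₁ * S t ^ 2)
      (k₂ * (2 * v t * (-k₁ * S t - k₂ * v t)) + k₁ * (2 * S t * (-k₁ * S t))) t := by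
    have h₁ := ((hS t).hasDerivAt.pow 2).const_mul k₁
    have h₂ := ((hv t).hasDerivAt.pow 2).const_mul k₂
    rw [hS' t] at h₁
    rw [hv' t] at h₂
    simpa using h₂.fun_add h₁
  have hlim := tendsto_zero_of_deriv_le_neg_mul (lt_min hk₁ hk₂) hV
    (fun t => by
      have h₁ := mul_nonneg (sub_nonneg.2 (min_le_left k₁ k₂)) (mul_nonneg hk₁.le (sq_nonneg (S t)))
      have h₂ := mul_nonneg (sub_nonneg.2 (min_le_right k₁ k₂))
        (mul_nonneg hk₂.le (sq_nonneg (v t)))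
      linarith [sq_nonneg (k₂ * v t + k₁ * S t)])
    (fun t => by positivity)
  exact ⟨tendsto_zero_of_mul_sq_le hk₁ hlim fun t => le_add_of_nonneg_left (by positivity),
    tendsto_zero_of_mul_sq_le hk₂ hlim fun t => le_add_of_nonneg_right (by positivity)⟩
end

section
/- Let k₁ > 0, k₂ > 0, t_h ∈ ℝ. The function ω ↦ M̃₁(ω)² = ((1−k₂t_h)²ω²(k₂²+ω²))/((k₁k₂−ω²)² + (k₁+k₂)²ω²) is monotone nondecreasing on [0, ∞). (Monotonicity step in the proof of Claim 1.) -/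
/-- Monotonicity step in the proof of Claim 1: `ω ↦ M̃₁(ω)²` is monotone
nondecreasing on `[0, ∞)`. -/
theorem M1_sq_monotone (k₁ k₂ th : ℝ) (hk₁ : k₁ > 0) (hk₂ : k₂ > 0) :
    MonotoneOn (fun ω : ℝ =>
      ((1 - k₂ * th) ^ 2 * ω ^ 2 * (k₂ ^ 2 + ω ^ 2)) /
        ((k₁ * k₂ - ω ^ 2) ^ 2 + (k₁ + k₂) ^ 2 * ω ^ 2))
      (Set.Ici (0 : ℝ)) := by
  have cancel (ω : ℝ) : ((1 - k₂ * th) ^ 2 * ω ^ 2 * (k₂ ^ 2 + ω ^ 2)) /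
      ((k₁ * k₂ - ω ^ 2) ^ 2 + (k₁ + k₂) ^ 2 * ω ^ 2) =
      (1 - k₂ * th) ^ 2 * (ω ^ 2 / (k₁ ^ 2 + ω ^ 2)) := by
    have factor : (k₁ * k₂ - ω ^ 2) ^ 2 + (k₁ + k₂) ^ 2 * ω ^ 2 =
        (k₁ ^ 2 + ω ^ 2) * (k₂ ^ 2 + ω ^ 2) := by ring
    rw [factor, mul_div_mul_right _ _ (by positivity), mul_div_assoc]
  intro a ha b _ hab
  have ha : 0 ≤ a := ha
  have hsq : a ^ 2 ≤ b ^ 2 := by gcongr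
  simp only [cancel]
  refine mul_le_mul_of_nonneg_left ?_ (sq_nonneg _)
  rw [div_le_div_iff₀ (by positivity) (by positivity)]
  nlinarith [mul_le_mul_of_nonneg_left hsq (sq_nonneg k₁)]
end

section
/- Let k₁ > 0, k₂ > 0, t_h ∈ ℝ. Then for every real ω, M̃₁(ω)² = ((1−k₂t_h)²ω²(k₂²+ω²))/((k₁k₂−ω²)² + (k₁+k₂)²ω²) ≤ (1 − k₂·t_h)². In particular, if k₂ = 1/t_h then M̃₁(ω) = 0 for all ω. (Claim 1: choosing k₂ near 1/t_h minimizes the upper bound on the tracking error magnitude.) -/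
/-- Claim 1: for all real `ω`, `M̃₁(ω)² ≤ (1 − k₂ t_h)²`; in particular, if
`k₂ = 1/t_h` then `M̃₁(ω) = 0` for all `ω`. -/
theorem M1_bound (k₁ k₂ th : ℝ) (hk₁ : k₁ > 0) (hk₂ : k₂ > 0) :
    (∀ ω : ℝ,
      ((1 - k₂ * th) ^ 2 * ω ^ 2 * (k₂ ^ 2 + ω ^ 2)) /
        ((k₁ * k₂ - ω ^ 2) ^ 2 + (k₁ + k₂) ^ 2 * ω ^ 2) ≤ (1 - k₂ * th) ^ 2) ∧
    (k₂ = 1 / th → ∀ ω : ℝ,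
      Real.sqrt (((1 - k₂ * th) ^ 2 * ω ^ 2 * (k₂ ^ 2 + ω ^ 2)) /
        ((k₁ * k₂ - ω ^ 2) ^ 2 + (k₁ + k₂) ^ 2 * ω ^ 2)) = 0) := by
  have hden (ω : ℝ) : (k₁ * k₂ - ω ^ 2) ^ 2 + (k₁ + k₂) ^ 2 * ω ^ 2 =
      (k₁ ^ 2 + ω ^ 2) * (k₂ ^ 2 + ω ^ 2) := by ring
  refine ⟨fun ω => ?_, fun h ω => ?_⟩
  · rw [hden, div_le_iff₀ (by positivity), mul_assoc]
    gcongr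
    exact le_add_of_nonneg_left (sq_nonneg k₁)
  · have hth : th ≠ 0 := by
      rintro rfl
      simp [h] at hk₂
    have hone : k₂ * th = 1 := by rw [h, one_div_mul_cancel hth]
    simp [hone]
end

section
/- Let k₁ > 0, k₂ > 0 and 0 < t_h ≤ t_h′. If k₁·t_h·(k₂ − 2) ≤ 2·(k₂·t_h − 1), then k₁·t_h′·(k₂ − 2) ≤ 2·(k₂·t_h′ − 1). (The string stable region in the (k₂, k₁)-plane shrinks as the desired time headway decreases.) -/
/-- The string stable region in the `(k₂, k₁)`-plane shrinks as the desired
time headway decreases: if the condition holds for `t_h`, it holds for any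
`t_h′ ≥ t_h`. -/
theorem string_stable_region_monotone (k₁ k₂ th th' : ℝ) (hk₁ : k₁ > 0) (hk₂ : k₂ > 0)
    (hth : 0 < th) (hth' : th ≤ th')
    (hcond : k₁ * th * (k₂ - 2) ≤ 2 * (k₂ * th - 1)) :
    k₁ * th' * (k₂ - 2) ≤ 2 * (k₂ * th' - 1) := by
  have hc : 0 < 2 * k₂ - k₁ * (k₂ - 2) :=
    pos_of_mul_pos_right (a := th) (by linarith) hth.le
  linarith [mul_le_mul_of_nonneg_right hth' hc.le]
end

section
/- Let b > 0 and c > 0, and let q(x) = g(x/c)·√(2·b·x·g(x/c) + c²) where g(x) = (2/π)·arctan((π/2)·x). Then q is strictly increasing on ℝ and is a bijection from ℝ onto ℝ (in particular q possesses an inverse function q⁻¹ defined on all of ℝ). (Shaping-function property 1 and existence of the inverse used in the closed-loop transformation.) -/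
open Filter in
/-- A continuous odd strictly increasing function that is unbounded above is a bijection. -/
theorem Continuous.bijective_of_odd_of_strictMono {f : ℝ → ℝ} (hf : Continuous f)
    (hodd : ∀ x, f (-x) = -f x) (hmono : StrictMono f) (htop : Tendsto f atTop atTop) :
    Function.Bijective f := by
  refine ⟨hmono.injective, hf.surjective htop ?_⟩
  have h : f = fun x => -f (-x) := by
    funext x
    rw [hodd, neg_neg]
  rw [h]
  exact tendsto_neg_atTop_atBot.comp (htop.comp tendsto_neg_atBot_atTop)

section SqrtWeight

variable {u : ℝ → ℝ} {a d : ℝ}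

theorem odd_mul_sqrt_weight (hodd : ∀ x, u (-x) = -u x) (x : ℝ) :
    u (-x) * √(a * (-x) * u (-x) + d) = -(u x * √(a * x * u x + d)) := by
  rw [hodd, show a * -x * -u x = a * x * u x by ring, neg_mul]

theorem strictMono_mul_sqrt_weight (ha : 0 ≤ a) (hd : 0 < d) (hodd : ∀ x, u (-x) = -u x)
    (hmono : StrictMono u) : StrictMono fun x => u x * √(a * x * u x + d) := by
  have h0 : u 0 = 0 := by
    have := hodd 0
    rw [neg_zero] at this
    linarith
  refine strictMono_of_odd_strictMonoOn_nonneg (odd_mul_sqrt_weight hodd) ?_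
  intro x hx y _ hxy
  have hx : 0 ≤ x := hx
  have hux : 0 ≤ u x := h0 ▸ hmono.monotone hx
  have huxy : u x < u y := hmono hxy
  have hle : a * x * u x + d ≤ a * y * u y + d := by
    have hy : 0 ≤ a * y := mul_nonneg ha (hx.trans hxy.le)
    gcongr
  have hpos : 0 < a * x * u x + d := by positivity
  exact mul_lt_mul huxy (Real.sqrt_le_sqrt hle) (Real.sqrt_pos.2 hpos) (hux.trans huxy.le)

open Filter in
theorem tendsto_atTop_mul_sqrt_weight (ha : 0 < a) (hodd : ∀ x, u (-x) = -u x)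
    (hmono : StrictMono u) : Tendsto (fun x => u x * √(a * x * u x + d)) atTop atTop := by
  have h1 : 0 < u 1 := by
    have := hmono (show (-1 : ℝ) < 1 by norm_num)
    rw [hodd] at this
    linarith
  have hlim : Tendsto (fun x => u 1 * √(a * u 1 * x + d)) atTop atTop :=
    (Real.tendsto_sqrt_atTop.comp (tendsto_atTop_add_const_right _ d
      (tendsto_id.const_mul_atTop (mul_pos ha h1)))).const_mul_atTop h1
  refine tendsto_atTop_mono' _ ?_ hlim
  filter_upwards [eventually_ge_atTop 1] with x hx
  have hux : u 1 ≤ u x := hmono.monotone hx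
  have hux0 : 0 ≤ u x := h1.le.trans hux
  rw [mul_right_comm a (u 1) x]
  gcongr

end SqrtWeight

/-- Shaping-function property 1 and existence of the inverse: `q` is strictly
increasing on `ℝ` and a bijection from `ℝ` onto `ℝ`. -/
theorem shaping_function_bijective (b c : ℝ) (hb : b > 0) (hc : c > 0)
    (g q : ℝ → ℝ)
    (hg : ∀ x, g x = (2 / Real.pi) * Real.arctan ((Real.pi / 2) * x))
    (hq : ∀ x, q x = g (x / c) * Real.sqrt (2 * b * x * g (x / c) + c ^ 2)) :
    StrictMono q ∧ Function.Bijective q := by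
  have hpi := Real.pi_pos
  have hg' : g = fun x => (2 / Real.pi) * Real.arctan ((Real.pi / 2) * x) := funext hg
  have hcont : Continuous g := by
    rw [hg']
    fun_prop
  have hodd : ∀ x, g (-x / c) = -g (x / c) := fun x => by
    rw [hg, hg, neg_div, mul_neg, Real.arctan_neg, mul_neg]
  have hmono : StrictMono fun x => g (x / c) := fun x y hxy => by
    simp only [hg]
    gcongr
  have hq' : q = fun x => g (x / c) * √(2 * b * x * g (x / c) + c ^ 2) := funext hq
  have hqmono : StrictMono q := hq' ▸
    strictMono_mul_sqrt_weight (by positivity) (by positivity) hodd hmono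
  refine ⟨hqmono, Continuous.bijective_of_odd_of_strictMono ?_ ?_ hqmono ?_⟩
  · rw [hq']
    fun_prop
  · simpa only [hq] using odd_mul_sqrt_weight (u := fun x => g (x / c)) hodd
  · exact hq' ▸ tendsto_atTop_mul_sqrt_weight (by positivity) hodd hmono
end

section
/- Let b > 0 and c > 0, and let q(x) = g(x/c)·√(2·b·x·g(x/c) + c²) where g(x) = (2/π)·arctan((π/2)·x). Then q(x) − √(2·b·x) → 0 as x → +∞, i.e., q has the curvilinear asymptote y = √(2bx). (Shaping-function property 3, matching the constant-comfortable-acceleration human-driving surface for large errors.) -/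
open Filter Topology

lemma mul_pi_div_two_sub_arctan_le_one {y : ℝ} (hy : 0 < y) :
    y * (Real.pi / 2 - Real.arctan y) ≤ 1 := by
  rw [← Real.arctan_inv_of_pos hy]
  calc y * Real.arctan y⁻¹ ≤ y * y⁻¹ := by
        gcongr
        have h := Real.le_tan (Real.arctan_nonneg.2 (inv_pos.2 hy).le)
          (Real.arctan_lt_pi_div_two y⁻¹)
        rwa [Real.tan_arctan] at h
    _ = 1 := mul_inv_cancel₀ hy.ne'

lemma mul_one_sub_arctan_wrapper_le_one {x : ℝ} (hx : 0 < x) :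
    x * (1 - (2 / Real.pi) * Real.arctan ((Real.pi / 2) * x)) ≤ 1 := by
  have hpi := Real.pi_gt_three
  have h := mul_pi_div_two_sub_arctan_le_one (y := Real.pi / 2 * x) (by positivity)
  have heq : Real.pi / 2 * x * (Real.pi / 2 - Real.arctan (Real.pi / 2 * x)) =
      (Real.pi / 2) ^ 2 * (x * (1 - (2 / Real.pi) * Real.arctan ((Real.pi / 2) * x))) := by
    field_simp
  rw [heq] at h
  nlinarith

lemma abs_mul_sqrt_sub_sqrt_le {a d m G : ℝ} (ha : 0 < a) (hd : 0 ≤ d) (hG0 : 0 ≤ G)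
    (hG1 : G ≤ 1) (hm : a * (1 - G) ≤ m) :
    |G * √(a * G + d) - √a| ≤ (3 * m + d) / √a := by
  have hs : 0 < √a := Real.sqrt_pos.2 ha
  have hr : 0 ≤ √(a * G + d) := Real.sqrt_nonneg _
  have hss : √a ^ 2 = a := Real.sq_sqrt ha.le
  have hrr : √(a * G + d) ^ 2 = a * G + d := Real.sq_sqrt (by positivity)
  have hGr : 0 ≤ G * √(a * G + d) := mul_nonneg hG0 hr
  have hprod : (G * √(a * G + d) - √a) * (G * √(a * G + d) + √a) =
      d * G ^ 2 - a * (1 - G) * (1 + G + G ^ 2) := by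
    linear_combination G ^ 2 * hrr - hss
  have ha1 : 0 ≤ a * (1 - G) := mul_nonneg ha.le (by linarith)
  have hG2 : G ^ 2 ≤ 1 := pow_le_one₀ hG0 hG1
  have hd1 : d * G ^ 2 ≤ d := mul_le_of_le_one_right hd hG2
  have hd0 : 0 ≤ d * G ^ 2 := by positivity
  have hm0 : 0 ≤ a * (1 - G) * (1 + G + G ^ 2) := by positivity
  have hm1 : a * (1 - G) * (1 + G + G ^ 2) ≤ m * 3 :=
    mul_le_mul hm (by linarith) (by positivity) (ha1.trans hm)
  rw [le_div_iff₀ hs]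
  calc |G * √(a * G + d) - √a| * √a
      ≤ |G * √(a * G + d) - √a| * (G * √(a * G + d) + √a) := by
        gcongr
        linarith
    _ = |d * G ^ 2 - a * (1 - G) * (1 + G + G ^ 2)| := by
        rw [← hprod, abs_mul, abs_of_nonneg (add_nonneg hGr hs.le)]
    _ ≤ 3 * m + d := abs_le.2 ⟨by linarith, by linarith⟩

/-- Shaping-function property 3: `q(x) − √(2bx) → 0` as `x → +∞`, i.e. `q` has
the curvilinear asymptote `y = √(2bx)`. -/
theorem shaping_function_asymptote (b c : ℝ) (hb : b > 0) (hc : c > 0)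
    (g q : ℝ → ℝ)
    (hg : ∀ x, g x = (2 / Real.pi) * Real.arctan ((Real.pi / 2) * x))
    (hq : ∀ x, q x = g (x / c) * Real.sqrt (2 * b * x * g (x / c) + c ^ 2)) :
    Tendsto (fun x => q x - Real.sqrt (2 * b * x)) atTop (𝓝 0) := by
  have hlim : Tendsto (fun x : ℝ => (3 * (2 * b * c) + c ^ 2) / √(2 * b * x)) atTop (𝓝 0) :=
    (Real.tendsto_sqrt_atTop.comp
      (tendsto_id.const_mul_atTop (by positivity : 0 < 2 * b))).const_div_atTop _
  refine squeeze_zero_norm' ?_ hlim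
  filter_upwards [eventually_gt_atTop 0] with x hx
  have hxc : 0 < x / c := div_pos hx hc
  have hpi := Real.pi_pos
  have hG0 : 0 ≤ g (x / c) := by
    rw [hg]
    exact mul_nonneg (by positivity) (Real.arctan_nonneg.2 (by positivity))
  have hG1 : g (x / c) ≤ 1 := by
    rw [hg, div_mul_eq_mul_div, div_le_one hpi]
    linarith [Real.arctan_lt_pi_div_two (Real.pi / 2 * (x / c))]
  have hx1 : x * (1 - g (x / c)) ≤ c := by
    have h := mul_one_sub_arctan_wrapper_le_one hxc
    rwa [← hg, div_mul_eq_mul_div, div_le_one hc] at h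
  rw [Real.norm_eq_abs, hq]
  refine abs_mul_sqrt_sub_sqrt_le (by positivity) (by positivity) hG0 hG1 ?_
  rw [mul_assoc (2 * b) x]
  gcongr
end
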